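/- For every x ∈ [0.42, 0.55], f_15(x, x) > 0; that is, in a side-out scoring game to 15 between evenly matched teams whose serve-win probability lies in [0.42, 0.55], the first-serving team has a strictly larger probability of winning than the second-serving team. -/

import Mathlib

/-- The four server designations in side-out scoring: Team A's first and second
servers and Team B's first and second servers. -/
inductive SOSrv : Type
  | A1 | A2 | B1 | B2
  deriving DecidableEq

/-- States of a game to `n` with four server designations: a (capped) score `(i, j)`
together with a server designation, or one of the two absorbing states. -/
inductive SOState (n : ℕ) : Type
  | game (i j : ℕ) (srv : SOSrv)
  | Awins
  | Bwins
  deriving DecidableEq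

/-- The capped scores of a game to `n`: both scores at most `n - 1`, or one of the two
advantage scores `(n - 1, n)`, `(n, n - 1)`. -/
def validScore (n i j : ℕ) : Prop :=
  (i ≤ n - 1 ∧ j ≤ n - 1) ∨ (i = n - 1 ∧ j = n) ∨ (i = n ∧ j = n - 1)

/-- Result of Team A scoring a point from (capped) score `(i, j)`, with server `srv`:
from deuce `(n-1, n-1)` to advantage `(n, n-1)`; from Team B's advantage `(n-1, n)`
back to deuce; from advantage `(n, n-1)` or from `(n-1, j)` with `j ≤ n-2`, Team A wins;
otherwise the score is incremented. -/
def soScoreA (n i j : ℕ) (srv : SOSrv) : SOState n :=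
  if i = n - 1 then
    if j = n - 1 then SOState.game n (n - 1) srv
    else if j = n then SOState.game (n - 1) (n - 1) srv
    else SOState.Awins
  else if i = n then SOState.Awins
  else SOState.game (i + 1) j srv

/-- Result of Team B scoring a point from (capped) score `(i, j)`, with server `srv`. -/
def soScoreB (n i j : ℕ) (srv : SOSrv) : SOState n :=
  if j = n - 1 then
    if i = n - 1 then SOState.game (n - 1) n srv
    else if i = n then SOState.game (n - 1) (n - 1) srv
    else SOState.Bwins
  else if j = n then SOState.Bwins
  else SOState.game i (j + 1) srv

/-- `soDist n pA pB k s t` : the probability that a side-out scoring game to `n` is in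
state `t` after `k` rallies, starting from state `s`.  When Team A serves it wins the
rally with probability `pA` (scoring a point and keeping the server); otherwise the
server designation advances `A1 → A2 → B1 → B2 → A1` (side out after two faults;
the game starts with the first-serving team's second server).  Similarly for Team B
with `pB`.  The absorbing states stay put. -/
def soDist (n : ℕ) (pA pB : ℝ) : ℕ → SOState n → SOState n → ℝ
  | 0, s, t => if t = s then 1 else 0
  | k + 1, SOState.Awins, t => soDist n pA pB k SOState.Awins t
  | k + 1, SOState.Bwins, t => soDist n pA pB k SOState.Bwins t
  | k + 1, SOState.game i j SOSrv.A1, t =>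
      pA * soDist n pA pB k (soScoreA n i j SOSrv.A1) t
        + (1 - pA) * soDist n pA pB k (SOState.game i j SOSrv.A2) t
  | k + 1, SOState.game i j SOSrv.A2, t =>
      pA * soDist n pA pB k (soScoreA n i j SOSrv.A2) t
        + (1 - pA) * soDist n pA pB k (SOState.game i j SOSrv.B1) t
  | k + 1, SOState.game i j SOSrv.B1, t =>
      pB * soDist n pA pB k (soScoreB n i j SOSrv.B1) t
        + (1 - pB) * soDist n pA pB k (SOState.game i j SOSrv.B2) t
  | k + 1, SOState.game i j SOSrv.B2, t =>
      pB * soDist n pA pB k (soScoreB n i j SOSrv.B2) t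
        + (1 - pB) * soDist n pA pB k (SOState.game i j SOSrv.A1) t

/-- Probability that Team A eventually wins the side-out scoring game, from state `s`. -/
noncomputable def soWinA (n : ℕ) (pA pB : ℝ) (s : SOState n) : ℝ :=
  ⨆ k : ℕ, soDist n pA pB k s SOState.Awins

/-- Probability that Team B eventually wins the side-out scoring game, from state `s`. -/
noncomputable def soWinB (n : ℕ) (pA pB : ℝ) (s : SOState n) : ℝ :=
  ⨆ k : ℕ, soDist n pA pB k s SOState.Bwins

/-- The first-serving team's advantage `f_n(p_A, p_B)` under side-out scoring to `n`:
P(Team A wins | Team A serves first) − P(Team A wins | Team B serves first).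
The game starts at score 0-0 with the first-serving team's second server. -/
noncomputable def soAdv (n : ℕ) (pA pB : ℝ) : ℝ :=
  soWinA n pA pB (SOState.game 0 0 SOSrv.A2) - soWinA n pA pB (SOState.game 0 0 SOSrv.B2)

/-! ### The winning probabilities satisfy the rally-by-rally recursion -/

section Recursion

variable {n : ℕ} {pA pB : ℝ}

theorem soDist_nonneg (hA : pA ∈ Set.Icc (0 : ℝ) 1) (hB : pB ∈ Set.Icc (0 : ℝ) 1)
    (t : SOState n) (k : ℕ) (s : SOState n) : 0 ≤ soDist n pA pB k s t := by
  obtain ⟨hA0, hA1⟩ := hA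
  obtain ⟨hB0, hB1⟩ := hB
  rw [← sub_nonneg] at hA1 hB1
  induction k generalizing s with
  | zero => simp only [soDist]; split_ifs <;> norm_num
  | succ k ih =>
    rcases s with ⟨i, j, _ | _ | _ | _⟩ | _ | _ <;> simp only [soDist]
    any_goals exact ih _
    all_goals
      exact add_nonneg (mul_nonneg (by assumption) (ih _)) (mul_nonneg (by assumption) (ih _))

theorem soDist_le_one (hA : pA ∈ Set.Icc (0 : ℝ) 1) (hB : pB ∈ Set.Icc (0 : ℝ) 1)
    (t : SOState n) (k : ℕ) (s : SOState n) : soDist n pA pB k s t ≤ 1 := by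
  obtain ⟨hA0, hA1⟩ := hA
  obtain ⟨hB0, hB1⟩ := hB
  rw [← sub_nonneg] at hA1 hB1
  induction k generalizing s with
  | zero => simp only [soDist]; split_ifs <;> norm_num
  | succ k ih =>
    rcases s with ⟨i, j, _ | _ | _ | _⟩ | _ | _ <;> simp only [soDist]
    any_goals exact ih _
    all_goals
      exact (add_le_add (mul_le_mul_of_nonneg_left (ih _) (by assumption))
        (mul_le_mul_of_nonneg_left (ih _) (by assumption))).trans_eq (by ring)

theorem soDist_Awins_le_succ (hA : pA ∈ Set.Icc (0 : ℝ) 1) (hB : pB ∈ Set.Icc (0 : ℝ) 1)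
    (k : ℕ) (s : SOState n) :
    soDist n pA pB k s .Awins ≤ soDist n pA pB (k + 1) s .Awins := by
  induction k generalizing s with
  | zero =>
    rcases s with ⟨i, j, srv⟩ | _ | _
    · simpa [soDist] using soDist_nonneg hA hB .Awins 1 (.game i j srv)
    · simp [soDist]
    · simp [soDist]
  | succ k ih =>
    obtain ⟨hA0, hA1⟩ := hA
    obtain ⟨hB0, hB1⟩ := hB
    rw [← sub_nonneg] at hA1 hB1
    rcases s with ⟨i, j, _ | _ | _ | _⟩ | _ | _
    all_goals rw [soDist, soDist]
    any_goals exact ih _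
    all_goals
      exact add_le_add (mul_le_mul_of_nonneg_left (ih _) (by assumption))
        (mul_le_mul_of_nonneg_left (ih _) (by assumption))

theorem tendsto_soDist_soWinA (hA : pA ∈ Set.Icc (0 : ℝ) 1) (hB : pB ∈ Set.Icc (0 : ℝ) 1)
    (s : SOState n) :
    Filter.Tendsto (fun k => soDist n pA pB k s .Awins) Filter.atTop
      (nhds (soWinA n pA pB s)) :=
  tendsto_atTop_ciSup (monotone_nat_of_le_succ fun k => soDist_Awins_le_succ hA hB k s)
    ⟨1, by rintro _ ⟨k, rfl⟩; exact soDist_le_one hA hB _ k s⟩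

theorem soWinA_Awins : soWinA n pA pB .Awins = 1 := by
  have h (k : ℕ) : soDist n pA pB k .Awins .Awins = 1 := by
    induction k with
    | zero => simp [soDist]
    | succ k ih => rw [soDist, ih]
  simp [soWinA, h]

theorem soWinA_Bwins : soWinA n pA pB .Bwins = 0 := by
  have h (k : ℕ) : soDist n pA pB k .Bwins .Awins = 0 := by
    induction k with
    | zero => simp [soDist]
    | succ k ih => rw [soDist, ih]
  simp [soWinA, h]

theorem soWinA_eq_of_soDist_succ (hA : pA ∈ Set.Icc (0 : ℝ) 1) (hB : pB ∈ Set.Icc (0 : ℝ) 1)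
    {p : ℝ} {s s₁ s₂ : SOState n}
    (h : ∀ k, soDist n pA pB (k + 1) s .Awins =
      p * soDist n pA pB k s₁ .Awins + (1 - p) * soDist n pA pB k s₂ .Awins) :
    soWinA n pA pB s = p * soWinA n pA pB s₁ + (1 - p) * soWinA n pA pB s₂ := by
  refine tendsto_nhds_unique
    ((tendsto_soDist_soWinA hA hB s).comp (Filter.tendsto_add_atTop_nat 1)) ?_
  simp only [Function.comp_def, h]
  exact ((tendsto_soDist_soWinA hA hB s₁).const_mul p).add
    ((tendsto_soDist_soWinA hA hB s₂).const_mul (1 - p))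

end Recursion

/-! ### Point-by-point recursion -/

/-- The relation between the winning probabilities `w` at a score (indexed by the server) and
those after the next point, `wA` if Team A scores it and `wB` if Team B does, when both teams
lose a rally on serve with probability `q`: the next point is scored by the `k`-th server in
line with probability proportional to `q ^ k`. -/
structure IsNextPoint (q : ℝ) (wA wB w : SOSrv → ℝ) : Prop where
  a₁ : (1 + q + q ^ 2 + q ^ 3) * w .A1 =
    wA .A1 + q * (wA .A2 + q * (wB .B1 + q * wB .B2))
  a₂ : (1 + q + q ^ 2 + q ^ 3) * w .A2 =
    wA .A2 + q * (wB .B1 + q * (wB .B2 + q * wA .A1))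
  b₁ : (1 + q + q ^ 2 + q ^ 3) * w .B1 =
    wB .B1 + q * (wB .B2 + q * (wA .A1 + q * wA .A2))
  b₂ : (1 + q + q ^ 2 + q ^ 3) * w .B2 =
    wB .B2 + q * (wA .A1 + q * (wA .A2 + q * wB .B1))

theorem isNextPoint_soWinA {n : ℕ} {x : ℝ} (hx : x ∈ Set.Ioc (0 : ℝ) 1) (i j : ℕ) :
    IsNextPoint (1 - x) (fun srv => soWinA n x x (soScoreA n i j srv))
      (fun srv => soWinA n x x (soScoreB n i j srv))
      (fun srv => soWinA n x x (.game i j srv)) := by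
  have hx' : x ∈ Set.Icc (0 : ℝ) 1 := ⟨hx.1.le, hx.2⟩
  have h₁ := soWinA_eq_of_soDist_succ (n := n) hx' hx' (s := .game i j .A1)
    fun k => by rw [soDist]
  have h₂ := soWinA_eq_of_soDist_succ (n := n) hx' hx' (s := .game i j .A2)
    fun k => by rw [soDist]
  have h₃ := soWinA_eq_of_soDist_succ (n := n) hx' hx' (s := .game i j .B1)
    fun k => by rw [soDist]
  have h₄ := soWinA_eq_of_soDist_succ (n := n) hx' hx' (s := .game i j .B2)
    fun k => by rw [soDist]
  constructor <;> refine mul_left_cancel₀ hx.1.ne' ?_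
  · linear_combination h₁ + (1 - x) * h₂ + (1 - x) ^ 2 * h₃ + (1 - x) ^ 3 * h₄
  · linear_combination h₂ + (1 - x) * h₃ + (1 - x) ^ 2 * h₄ + (1 - x) ^ 3 * h₁
  · linear_combination h₃ + (1 - x) * h₄ + (1 - x) ^ 2 * h₁ + (1 - x) ^ 3 * h₂
  · linear_combination h₄ + (1 - x) * h₁ + (1 - x) ^ 2 * h₂ + (1 - x) ^ 3 * h₃

/-- Team A's winning probability in a game to 15 when Team A needs `a` and Team B needs `b` more
points to reach 15, extended by the final scores `a = 0` and `b = 0`. -/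
noncomputable def remWinA (x : ℝ) (a b : ℕ) (srv : SOSrv) : ℝ :=
  if a = 0 then 1 else if b = 0 then 0 else soWinA 15 x x (.game (15 - a) (15 - b) srv)

theorem isNextPoint_remWinA {x : ℝ} (hx : x ∈ Set.Ioc (0 : ℝ) 1) {a b : ℕ} (ha : a < 15)
    (hb : b < 15) (hab : a ≠ 0 ∨ b ≠ 0) :
    IsNextPoint (1 - x) (remWinA x a (b + 1)) (remWinA x (a + 1) b)
      (remWinA x (a + 1) (b + 1)) := by
  have hA (srv : SOSrv) : soWinA 15 x x (soScoreA 15 (15 - (a + 1)) (15 - (b + 1)) srv) =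
      remWinA x a (b + 1) srv := by
    rcases Nat.eq_zero_or_pos a with rfl | ha'
    · have h₁ : 15 - (b + 1) ≠ 15 - 1 := by omega
      have h₂ : 15 - (b + 1) ≠ 15 := by omega
      rw [soScoreA, if_pos rfl, if_neg h₁, if_neg h₂, soWinA_Awins, remWinA, if_pos rfl]
    · have h₁ : 15 - (a + 1) ≠ 15 - 1 := by omega
      have h₂ : 15 - (a + 1) ≠ 15 := by omega
      have h₃ : 15 - (a + 1) + 1 = 15 - a := by omega
      rw [soScoreA, if_neg h₁, if_neg h₂, h₃, remWinA, if_neg ha'.ne', if_neg b.succ_ne_zero]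
  have hB (srv : SOSrv) : soWinA 15 x x (soScoreB 15 (15 - (a + 1)) (15 - (b + 1)) srv) =
      remWinA x (a + 1) b srv := by
    rcases Nat.eq_zero_or_pos b with rfl | hb'
    · have h₁ : 15 - (a + 1) ≠ 15 - 1 := by omega
      have h₂ : 15 - (a + 1) ≠ 15 := by omega
      rw [soScoreB, if_pos rfl, if_neg h₁, if_neg h₂, soWinA_Bwins, remWinA,
        if_neg a.succ_ne_zero, if_pos rfl]
    · have h₁ : 15 - (b + 1) ≠ 15 - 1 := by omega
      have h₂ : 15 - (b + 1) ≠ 15 := by omega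
      have h₃ : 15 - (b + 1) + 1 = 15 - b := by omega
      rw [soScoreB, if_neg h₁, if_neg h₂, h₃, remWinA, if_neg a.succ_ne_zero, if_neg hb'.ne']
  have h := isNextPoint_soWinA (n := 15) hx (15 - (a + 1)) (15 - (b + 1))
  simp only [hA, hB] at h
  exact h

/-! ### Polynomials as coefficient lists -/

/-- The value at `q` of the polynomial with coefficient list `l`, constant term first. -/
def polyEval (q : ℝ) : List ℤ → ℝ
  | [] => 0
  | c :: l => c + q * polyEval q l

/-- Addition of coefficient lists. -/
def polyAdd : List ℤ → List ℤ → List ℤ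
  | [], m => m
  | c :: l, [] => c :: l
  | c :: l, d :: m => (c + d) :: polyAdd l m

/-- The polynomial `l₀ + q l₁ + q² l₂ + q³ l₃`. -/
def polyTurn (l₀ l₁ l₂ l₃ : List ℤ) : List ℤ :=
  polyAdd l₀ (0 :: polyAdd l₁ (0 :: polyAdd l₂ (0 :: l₃)))

/-- The polynomial `(1 - q²) ^ k l`. -/
def polyMulPow : ℕ → List ℤ → List ℤ
  | 0, l => l
  | k + 1, l => polyMulPow k (polyAdd l (0 :: 0 :: l.map (- ·)))

theorem polyEval_add (q : ℝ) (l m : List ℤ) :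
    polyEval q (polyAdd l m) = polyEval q l + polyEval q m := by
  induction l generalizing m with
  | nil => simp [polyAdd, polyEval]
  | cons c l ih =>
    cases m with
    | nil => simp [polyAdd, polyEval]
    | cons d m => simp only [polyAdd, polyEval, ih]; push_cast; ring

theorem polyEval_turn (q : ℝ) (l₀ l₁ l₂ l₃ : List ℤ) :
    polyEval q (polyTurn l₀ l₁ l₂ l₃) =
      polyEval q l₀ + q * (polyEval q l₁ + q * (polyEval q l₂ + q * polyEval q l₃)) := by
  simp [polyTurn, polyEval_add, polyEval]

theorem polyEval_neg (q : ℝ) (l : List ℤ) : polyEval q (l.map (- ·)) = -polyEval q l := by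
  induction l with
  | nil => simp [polyEval]
  | cons c l ih => simp only [List.map_cons, polyEval, ih]; push_cast; ring

theorem polyEval_mulPow (q : ℝ) (k : ℕ) (l : List ℤ) :
    polyEval q (polyMulPow k l) = (1 - q ^ 2) ^ k * polyEval q l := by
  induction k generalizing l with
  | zero => simp [polyMulPow]
  | succ k ih =>
    simp only [polyMulPow, ih, polyEval_add, polyEval, polyEval_neg, Int.cast_zero]
    ring

/-! ### Numerators of the winning probabilities -/

/-- Coefficient lists of four polynomials, one for each server. -/
structure SrvPoly where
  a₁ : List ℤ
  a₂ : List ℤ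
  b₁ : List ℤ
  b₂ : List ℤ

namespace SrvPoly

/-- The same polynomial for every server. -/
def const (l : List ℤ) : SrvPoly := ⟨l, l, l, l⟩

/-- Numerators at a score, given those after a point by Team A and after a point by Team B. -/
def step (P Q : SrvPoly) : SrvPoly :=
  ⟨polyTurn P.a₁ P.a₂ Q.b₁ Q.b₂, polyTurn P.a₂ Q.b₁ Q.b₂ P.a₁,
    polyTurn Q.b₁ Q.b₂ P.a₁ P.a₂, polyTurn Q.b₂ P.a₁ P.a₂ Q.b₁⟩

/-- Numerators along a row (Team A's score fixed, Team B's score decreasing), given the row in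
which Team A has one more point and the numerators `Q` just before the first entry. -/
def nextRow (Q : SrvPoly) : List SrvPoly → List SrvPoly
  | [] => []
  | P :: l => P.step Q :: nextRow (P.step Q) l

/-- The polynomials `(1 + q + q² + q³) ^ m l` for `m < k`. -/
def winRow : ℕ → List ℤ → List SrvPoly
  | 0, _ => []
  | k + 1, l => const l :: winRow k (polyTurn l l l l)

/-- Numerators at deuce. -/
def deuce : SrvPoly :=
  ⟨[1, 1, 2, -2, 2], [1, -1, 4, -1, 0, 1], [0, 0, 3, 1, -2, 2], [0, 2, 1, 0, 0, 1]⟩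

/-- Numerators at the scores at which Team A needs `k + 1` more points to reach 15. -/
def row : ℕ → List SrvPoly
  | 0 => deuce :: nextRow deuce (winRow 14 [1, 1, 5, -1, 0, 2])
  | k + 1 => nextRow (const []) (row k)

/-- `P` lists the values `c * w srv` as polynomials in `q`. -/
structure Represents (q c : ℝ) (w : SOSrv → ℝ) (P : SrvPoly) : Prop where
  a₁ : c * w .A1 = polyEval q P.a₁
  a₂ : c * w .A2 = polyEval q P.a₂
  b₁ : c * w .B1 = polyEval q P.b₁
  b₂ : c * w .B2 = polyEval q P.b₂

theorem Represents.step {q c : ℝ} {wA wB w : SOSrv → ℝ} {P Q : SrvPoly}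
    (hP : P.Represents q c wA) (hQ : Q.Represents q c wB) (h : IsNextPoint q wA wB w) :
    (P.step Q).Represents q (c * (1 + q + q ^ 2 + q ^ 3)) w := by
  constructor <;>
    simp only [SrvPoly.step, polyEval_turn, ← hP.a₁, ← hP.a₂, ← hQ.b₁, ← hQ.b₂]
  · linear_combination c * h.a₁
  · linear_combination c * h.a₂
  · linear_combination c * h.b₁
  · linear_combination c * h.b₂

theorem length_nextRow (Q : SrvPoly) (l : List SrvPoly) : (nextRow Q l).length = l.length := by
  induction l generalizing Q with
  | nil => rfl
  | cons P l ih => simp [nextRow, ih]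

theorem length_winRow (k : ℕ) (l : List ℤ) : (winRow k l).length = k := by
  induction k generalizing l with
  | zero => rfl
  | succ k ih => simp [winRow, ih]

theorem length_row (k : ℕ) : (row k).length = 15 := by
  induction k with
  | zero => simp [row, length_nextRow, length_winRow]
  | succ k ih => simp [row, length_nextRow, ih]

theorem represents_nextRow {q c : ℝ} {f g : ℕ → SOSrv → ℝ} {Q : SrvPoly} {l : List SrvPoly}
    (hQ : Q.Represents q c (g 0))
    (hl : ∀ (m : ℕ) (P : SrvPoly), l[m]? = some P →
      P.Represents q (c * (1 + q + q ^ 2 + q ^ 3) ^ m) (f m))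
    (hfg : ∀ m < l.length, IsNextPoint q (f m) (g m) (g (m + 1))) (m : ℕ) (P : SrvPoly)
    (hP : (nextRow Q l)[m]? = some P) :
    P.Represents q (c * (1 + q + q ^ 2 + q ^ 3) ^ (m + 1)) (g (m + 1)) := by
  induction l generalizing c f g Q m with
  | nil => simp [nextRow] at hP
  | cons R l ih =>
    have h₀ : (R.step Q).Represents q (c * (1 + q + q ^ 2 + q ^ 3)) (g 1) :=
      Represents.step (by simpa using hl 0 R rfl) hQ (hfg 0 (by simp))
    cases m with
    | zero =>
      obtain rfl : R.step Q = P := by simpa [nextRow] using hP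
      simpa using h₀
    | succ m =>
      have h := ih (f := fun m => f (m + 1)) (g := fun m => g (m + 1)) h₀
        (fun k S hS => by simpa [pow_succ', mul_assoc] using hl (k + 1) S (by simpa using hS))
        (fun k hk => hfg (k + 1) (by simpa using hk)) m (by simpa [nextRow] using hP)
      rwa [mul_assoc, ← pow_succ'] at h

theorem represents_winRow {q c : ℝ} {k : ℕ} {l : List ℤ} (hl : polyEval q l = c) (m : ℕ)
    (P : SrvPoly) (hP : (winRow k l)[m]? = some P) :
    P.Represents q (c * (1 + q + q ^ 2 + q ^ 3) ^ m) fun _ => 1 := by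
  induction k generalizing c l m with
  | zero => simp [winRow] at hP
  | succ k ih =>
    cases m with
    | zero =>
      obtain rfl : const l = P := by simpa [winRow] using hP
      constructor <;> simp [const, hl]
    | succ m =>
      have h := ih (c := c * (1 + q + q ^ 2 + q ^ 3)) (by rw [polyEval_turn, hl]; ring) m
        (by simpa [winRow] using hP)
      rwa [mul_assoc, ← pow_succ'] at h

theorem represents_deuce {q : ℝ} (hq : q ∈ Set.Ico (0 : ℝ) 1) {wA wB w : SOSrv → ℝ}
    (hw : IsNextPoint q wA wB w) (hA : IsNextPoint q (fun _ => 1) w wA)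
    (hB : IsNextPoint q w (fun _ => 0) wB) :
    deuce.Represents q (1 + q + 5 * q ^ 2 - q ^ 3 + 2 * q ^ 5) w := by
  obtain ⟨h0, h1⟩ := hq
  set d := 1 + q + 5 * q ^ 2 - q ^ 3 + 2 * q ^ 5 with hd
  set E := 1 + q + q ^ 2 + q ^ 3 with hE
  set e₁ := d * w .A1 - polyEval q deuce.a₁ with he₁
  set e₂ := d * w .A2 - polyEval q deuce.a₂ with he₂
  set e₃ := d * w .B1 - polyEval q deuce.b₁ with he₃
  set e₄ := d * w .B2 - polyEval q deuce.b₂ with he₄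
  simp only [deuce, polyEval] at he₁ he₂ he₃ he₄
  push_cast at he₁ he₂ he₃ he₄
  have k₁ : E ^ 2 * e₁ = 2 * q ^ 2 * (e₃ + q * e₄) + 2 * q ^ 4 * (e₁ + q * e₂) := by
    rw [he₁, he₂, he₃, he₄]
    linear_combination (norm := skip) d * (E * hw.a₁ + hA.a₁ + q * hA.a₂ + q ^ 2 * hB.b₁ +
      q ^ 3 * hB.b₂)
    rw [hE, hd]; ring
  have k₂ : E ^ 2 * e₂ = (q + q ^ 5) * (e₃ + q * e₄) + 2 * q ^ 3 * (e₁ + q * e₂) := by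
    rw [he₁, he₂, he₃, he₄]
    linear_combination (norm := skip) d * (E * hw.a₂ + hA.a₂ + q * hB.b₁ + q ^ 2 * hB.b₂ +
      q ^ 3 * hA.a₁)
    rw [hE, hd]; ring
  have k₃ : E ^ 2 * e₃ = 2 * q ^ 2 * (e₁ + q * e₂) + 2 * q ^ 4 * (e₃ + q * e₄) := by
    rw [he₁, he₂, he₃, he₄]
    linear_combination (norm := skip) d * (E * hw.b₁ + hB.b₁ + q * hB.b₂ + q ^ 2 * hA.a₁ +
      q ^ 3 * hA.a₂)
    rw [hE, hd]; ring
  have k₄ : E ^ 2 * e₄ = (q + q ^ 5) * (e₁ + q * e₂) + 2 * q ^ 3 * (e₃ + q * e₄) := by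
    rw [he₁, he₂, he₃, he₄]
    linear_combination (norm := skip) d * (E * hw.b₂ + hB.b₂ + q * hA.a₁ + q ^ 2 * hA.a₂ +
      q ^ 3 * hB.b₁)
    rw [hE, hd]; ring
  have hEpos : 0 < E := by positivity
  have hlt : q ^ 4 ≤ q ^ 3 := pow_le_pow_of_le_one h0 h1.le (by norm_num)
  have hs : 0 < E ^ 2 - 3 * q ^ 2 - q ^ 6 - 4 * q ^ 4 := by
    have h : E ^ 2 - 3 * q ^ 2 - q ^ 6 - 4 * q ^ 4 =
      1 + 2 * q + 3 * q ^ 3 + (q ^ 3 - q ^ 4) + 2 * q ^ 5 := by rw [hE]; ring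
    rw [h]
    have := sub_nonneg.2 hlt
    positivity
  have ht : 0 < E ^ 2 + 3 * q ^ 2 + q ^ 6 - 4 * q ^ 4 := by
    have : 0 ≤ q ^ 2 := by positivity
    have : 0 ≤ q ^ 6 := by positivity
    linarith
  have hsum : e₁ + q * e₂ + (e₃ + q * e₄) = 0 := by
    refine (mul_eq_zero.1 ?_).resolve_left hs.ne'
    linear_combination k₁ + q * k₂ + k₃ + q * k₄
  have hdiff : e₁ + q * e₂ - (e₃ + q * e₄) = 0 := by
    refine (mul_eq_zero.1 ?_).resolve_left ht.ne'
    linear_combination k₁ + q * k₂ - k₃ - q * k₄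
  have hE2 : E ^ 2 ≠ 0 := by positivity
  have hA0 : e₁ + q * e₂ = 0 := by linarith
  have hB0 : e₃ + q * e₄ = 0 := by linarith
  constructor <;> rw [← sub_eq_zero] <;> refine (mul_eq_zero.1 ?_).resolve_left hE2
  · exact k₁.trans (by rw [hA0, hB0]; ring)
  · exact k₂.trans (by rw [hA0, hB0]; ring)
  · exact k₃.trans (by rw [hA0, hB0]; ring)
  · exact k₄.trans (by rw [hA0, hB0]; ring)

end SrvPoly

theorem represents_deuce_remWinA {x : ℝ} (hx : x ∈ Set.Ioc (0 : ℝ) 1) :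
    SrvPoly.deuce.Represents (1 - x)
      (1 + (1 - x) + 5 * (1 - x) ^ 2 - (1 - x) ^ 3 + 2 * (1 - x) ^ 5) (remWinA x 1 1) := by
  have hd := isNextPoint_soWinA (n := 15) hx 14 14
  have hA := isNextPoint_soWinA (n := 15) hx 15 14
  have hB := isNextPoint_soWinA (n := 15) hx 14 15
  simp only [soScoreA, soScoreB] at hd hA hB
  norm_num [soWinA_Awins, soWinA_Bwins] at hd hA hB
  exact SrvPoly.represents_deuce ⟨sub_nonneg.2 hx.2, sub_lt_self _ hx.1⟩ hd hA hB

theorem represents_row {x : ℝ} (hx : x ∈ Set.Ioc (0 : ℝ) 1) {k : ℕ} (hk : k < 15) (m : ℕ)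
    (P : SrvPoly) (hP : (SrvPoly.row k)[m]? = some P) :
    P.Represents (1 - x)
      ((1 + (1 - x) + 5 * (1 - x) ^ 2 - (1 - x) ^ 3 + 2 * (1 - x) ^ 5) *
        (1 + (1 - x) + (1 - x) ^ 2 + (1 - x) ^ 3) ^ (k + m))
      (remWinA x (k + 1) (m + 1)) := by
  induction k generalizing m P with
  | zero =>
    cases m with
    | zero =>
      obtain rfl : SrvPoly.deuce = P := by simpa [SrvPoly.row] using hP
      simpa using represents_deuce_remWinA hx
    | succ m =>
      rw [zero_add]
      refine SrvPoly.represents_nextRow (f := fun m => remWinA x 0 (m + 2))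
        (g := fun m => remWinA x 1 (m + 1)) (represents_deuce_remWinA hx)
        (SrvPoly.represents_winRow ?_) (fun i hi => ?_) m P hP
      · simp only [polyEval]; push_cast; ring
      · rw [SrvPoly.length_winRow] at hi
        exact isNextPoint_remWinA hx (by norm_num) (by omega) (.inr i.succ_ne_zero)
  | succ k ih =>
    have h := SrvPoly.represents_nextRow (f := fun m => remWinA x (k + 1) (m + 1))
      (g := remWinA x (k + 2)) (Q := .const []) (l := SrvPoly.row k) (q := 1 - x)
      (c := (1 + (1 - x) + 5 * (1 - x) ^ 2 - (1 - x) ^ 3 + 2 * (1 - x) ^ 5) *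
        (1 + (1 - x) + (1 - x) ^ 2 + (1 - x) ^ 3) ^ k)
      (by constructor <;> simp [remWinA, SrvPoly.const, polyEval])
      (fun i S hS => by rw [mul_assoc, ← pow_add]; exact ih (by omega) i S hS)
      (fun i hi => by
        rw [SrvPoly.length_row] at hi
        exact isNextPoint_remWinA hx hk hi (.inl k.succ_ne_zero))
      m P hP
    rwa [mul_assoc, ← pow_add, show k + (m + 1) = k + 1 + m by omega] at h

/-! ### The advantage polynomial -/

/-- The factor of the numerator of `soAdv 15 (1 - q) (1 - q)` that determines its sign. -/
def advPoly : List ℤ :=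
  [1, 0, -194, 26, 7917, -2028, -118300, 44616, 793793, -408980, -2576574, 1840410, 3864861,
    -4416984, -1472328, 5889312, -2760615, -4416984, 3721718, 1840410, -1860859, -408980, 440076,
    44616, -48503, -2028, 2170, 26, -27]

/-- The polynomial `(1 - q) (1 + q²) (1 - q²) ^ 28 advPoly(q)`. -/
def advNumerator : List ℤ :=
  let l := polyAdd advPoly (0 :: 0 :: advPoly)
  polyMulPow 28 (polyAdd l (0 :: l.map (- ·)))

theorem polyEval_advNumerator (q : ℝ) :
    polyEval q advNumerator =
      (1 - q) * (1 + q ^ 2) * (1 - q ^ 2) ^ 28 * polyEval q advPoly := by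
  simp only [advNumerator, polyEval_mulPow, polyEval_add, polyEval, polyEval_neg, Int.cast_zero]
  ring

theorem row_last_a₂_eq_add_advNumerator : (SrvPoly.row 14)[14]?.map
    (fun P => decide (P.a₂ = polyAdd P.b₂ advNumerator)) = some true := by
  decide +kernel

/-- Positivity of `advPoly`, from its expansion in the Bernstein basis of `[9/20, 7/12]`. -/
theorem polyEval_advPoly_pos {q : ℝ} (h₁ : 9 / 20 ≤ q) (h₂ : q < 7 / 12) :
    0 < polyEval q advPoly := by
  have hu : 0 ≤ 20 * q - 9 := by linarith
  have hv : 0 < 7 - 12 * q := by linarith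
  have h : 1393796574908163946345982392040522594123776 * polyEval q advPoly =
      1330338249671619085239599534759008813 * (7 - 12 * q) ^ 28 +
      41672566084814554710731626832058624660 * (20 * q - 9) * (7 - 12 * q) ^ 27 +
      506469957117447772265723221253968992754 * (20 * q - 9) ^ 2 * (7 - 12 * q) ^ 26 +
      3571262762650365223592151964932873356452 * (20 * q - 9) ^ 3 * (7 - 12 * q) ^ 25 +
      17105274787511431851909037204562171974047 * (20 * q - 9) ^ 4 * (7 - 12 * q) ^ 24 +
      60435782952893337841851113222935132400952 * (20 * q - 9) ^ 5 * (7 - 12 * q) ^ 23 +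
      165560327149377984676466834924185570240724 * (20 * q - 9) ^ 6 * (7 - 12 * q) ^ 22 +
      363377176116469431038427944424622666874616 * (20 * q - 9) ^ 7 * (7 - 12 * q) ^ 21 +
      653705400416839561035177613060862688765845 * (20 * q - 9) ^ 8 * (7 - 12 * q) ^ 20 +
      979747925450264884332711069790663680799484 * (20 * q - 9) ^ 9 * (7 - 12 * q) ^ 19 +
      1237977471831328662572921973645528003342126 * (20 * q - 9) ^ 10 * (7 - 12 * q) ^ 18 +
      1330235025176302290567069438347151548663628 * (20 * q - 9) ^ 11 * (7 - 12 * q) ^ 17 +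
      1223000205004698614721502795042607056744863 * (20 * q - 9) ^ 12 * (7 - 12 * q) ^ 16 +
      966023488913872367396485829238397755885648 * (20 * q - 9) ^ 13 * (7 - 12 * q) ^ 15 +
      657097560414894889058821997989906845714456 * (20 * q - 9) ^ 14 * (7 - 12 * q) ^ 14 +
      385189246579841074054904207589115672351824 * (20 * q - 9) ^ 15 * (7 - 12 * q) ^ 13 +
      194430584401175805285686637472021220435487 * (20 * q - 9) ^ 16 * (7 - 12 * q) ^ 12 +
      84303389697527089433613930322333296436812 * (20 * q - 9) ^ 17 * (7 - 12 * q) ^ 11 +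
      31267264273669635263655731826662450811182 * (20 * q - 9) ^ 18 * (7 - 12 * q) ^ 10 +
      9857716362960038830970298144431618080764 * (20 * q - 9) ^ 19 * (7 - 12 * q) ^ 9 +
      2618635145727617635199323890353913728021 * (20 * q - 9) ^ 20 * (7 - 12 * q) ^ 8 +
      579048337429534752081736602371640622328 * (20 * q - 9) ^ 21 * (7 - 12 * q) ^ 7 +
      104818551711722982375163325378771747028 * (20 * q - 9) ^ 22 * (7 - 12 * q) ^ 6 +
      15173237428087353415387602339870015288 * (20 * q - 9) ^ 23 * (7 - 12 * q) ^ 5 +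
      1697821926972438879973952652869130271 * (20 * q - 9) ^ 24 * (7 - 12 * q) ^ 4 +
      139395684931489251502612063209228708 * (20 * q - 9) ^ 25 * (7 - 12 * q) ^ 3 +
      7692594272314788288274273227150322 * (20 * q - 9) ^ 26 * (7 - 12 * q) ^ 2 +
      240055068100250899721642963640724 * (20 * q - 9) ^ 27 * (7 - 12 * q) +
      2639040544357958708076422041773 * (20 * q - 9) ^ 28 := by
    simp only [advPoly, polyEval]
    push_cast
    ring
  refine pos_of_mul_pos_right (a := 1393796574908163946345982392040522594123776) ?_ (by norm_num)
  rw [h]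
  positivity

/-- For every `x ∈ [0.42, 0.55]`, `f_15(x, x) > 0`: in a side-out scoring
game to 15 between evenly matched teams with serve-win probability in `[0.42, 0.55]`,
the first-serving team has a strictly larger probability of winning. -/
theorem soAdv_fifteen_pos (x : ℝ) (hx : x ∈ Set.Icc (0.42 : ℝ) 0.55) :
    0 < soAdv 15 x x := by
  obtain ⟨hx₁, hx₂⟩ := hx
  norm_num at hx₁ hx₂
  have hx : x ∈ Set.Ioc (0 : ℝ) 1 := ⟨by linarith, by linarith⟩
  obtain ⟨P, hP, hdec⟩ := Option.map_eq_some_iff.1 row_last_a₂_eq_add_advNumerator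
  have hrep := represents_row hx (by norm_num) 14 P hP
  have hpoly := polyEval_add (1 - x) P.b₂ advNumerator
  rw [← of_decide_eq_true hdec, ← hrep.a₂, ← hrep.b₂, polyEval_advNumerator] at hpoly
  have hadv : soAdv 15 x x = remWinA x 15 15 .A2 - remWinA x 15 15 .B2 := by
    simp [soAdv, remWinA]
  have hpos : 0 < polyEval (1 - x) advPoly :=
    polyEval_advPoly_pos (by linarith) (by linarith)
  have hq : 0 < 1 - x := by linarith
  have hq₁ : 0 < 1 - (1 - x) := by linarith [hx.1]
  have hq₂ : 0 < 1 - (1 - x) ^ 2 := by nlinarith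
  have hc : 0 < 1 + (1 - x) + 5 * (1 - x) ^ 2 - (1 - x) ^ 3 + 2 * (1 - x) ^ 5 := by
    have : 0 < (1 - x) ^ 2 * x := by have := hx.1; positivity
    have : 0 < (1 - x) ^ 5 := by positivity
    nlinarith [sq_nonneg (1 - x)]
  rw [hadv]
  refine pos_of_mul_pos_right (a :=
    (1 + (1 - x) + 5 * (1 - x) ^ 2 - (1 - x) ^ 3 + 2 * (1 - x) ^ 5) *
      (1 + (1 - x) + (1 - x) ^ 2 + (1 - x) ^ 3) ^ (14 + 14)) ?_ (by positivity)
  rw [mul_sub, hpoly, add_sub_cancel_left]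
  positivity
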